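/- Fix λ > 0, a Borel probability measure F on [0,∞) with ∫ r^d F(dr) < ∞ that follows a power law with tail exponent α > d, and a probability kernel G = (G_r)_{r≥0} on [0,∞), and let h, q, and k_th be defined by the explicit formulas below. Assume that h(r) → 0 as r → ∞, and that there is a function q_∞ : [0,∞)² → ℝ such that for all r₁, r₂ ≥ 0, q(|z|, r₁, r₂)/(F̄(|z|)·|z|^d) → q_∞(r₁, r₂) as |z| → ∞. Then k_th(z)/(F̄(|z|)·|z|^d) → c as |z| → ∞, where c = λ²·|B_1(0)|²·∬ r₁^d·r₂^d·q_∞(r₁,r₂) F(dr₁) F(dr₂). -/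

import Mathlib

open MeasureTheory Filter Set Metric ProbabilityTheory

noncomputable section

/-- A measurable positive function is slowly varying at infinity if `ℓ(a t)/ℓ(t) → 1`
as `t → ∞` for every `a > 0`. -/
def SlowlyVarying (ℓ : ℝ → ℝ) : Prop :=
  Measurable ℓ ∧ (∀ x > 0, 0 < ℓ x) ∧
    ∀ a > 0, Tendsto (fun t => ℓ (a * t) / ℓ t) atTop (nhds 1)

/-- Tail function `F̄(x) = F((x,∞))` of a measure on `ℝ`. -/
def tailF (F : Measure ℝ) (x : ℝ) : ℝ := (F (Ioi x)).toReal

/-- `d`-dimensional Euclidean space. -/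
abbrev Euc (d : ℕ) := EuclideanSpace ℝ (Fin d)

/-- The first standard basis vector of `ℝ^d`. -/
def e1 (d : ℕ) : Euc d := if h : 0 < d then EuclideanSpace.single (⟨0, h⟩ : Fin d) 1 else 0

/-- Volume of the closed ball of radius `r` in `ℝ^d`. -/
def ballVol (d : ℕ) (r : ℝ) : ℝ := (volume (closedBall (0 : Euc d) r)).toReal

/-- Volume of the intersection of closed balls `B_r(x)` and `B_s(y)` in `ℝ^d`. -/
def interVol (d : ℕ) (x : Euc d) (r : ℝ) (y : Euc d) (s : ℝ) : ℝ :=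
  (volume (closedBall x r ∩ closedBall y s)).toReal

/-- The constant `c_{α,d} = ∫₀^∞ |B_r(0) ∩ B_r(e₁)| α r^{-α-1} dr`. -/
def cconst (d : ℕ) (α : ℝ) : ℝ :=
  ∫ r in Ioi (0 : ℝ), interVol d 0 r (e1 d) r * (α * r ^ (-α - 1))

/-- `F` follows a power law with tail exponent `α`: `F̄(r) = ℓ(r) r^{-α}` with `ℓ`
slowly varying. -/
def IsPowerLaw (F : Measure ℝ) (α : ℝ) : Prop :=
  ∃ ℓ : ℝ → ℝ, SlowlyVarying ℓ ∧ ∀ x > 0, tailF F x = ℓ x * x ^ (-α)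

/-- Retention probability of a grain with radius `r` and weight `w`. -/
def hret (d : ℕ) (lam : ℝ) (F : Measure ℝ) (G : Kernel ℝ ℝ) (r w : ℝ) : ℝ :=
  Real.exp (-(lam * ∫ s, ballVol d (r + s) * ((G s) (Ici w)).toReal ∂F))

/-- Weight-averaged retention probability of a grain with radius `r`. -/
def havg (d : ℕ) (lam : ℝ) (F : Measure ℝ) (G : Kernel ℝ ℝ) (r : ℝ) : ℝ :=
  ∫ w, hret d lam F G r w ∂(G r)

/-- Pair retention probability of grains with radii `r₁, r₂`, weights `w₁, w₂` and
centers at distance `u` apart. -/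
def h2ret (d : ℕ) (lam : ℝ) (F : Measure ℝ) (G : Kernel ℝ ℝ)
    (u r₁ w₁ r₂ w₂ : ℝ) : ℝ :=
  if u ≤ r₁ + r₂ then 0
  else
    hret d lam F G r₁ w₁ * hret d lam F G r₂ w₂ *
      Real.exp (lam * ∫ r, interVol d 0 (r + r₁) (u • e1 d) (r + r₂) *
        ((G r) (Ici (max w₁ w₂))).toReal ∂F)

/-- Weight-averaged pair retention probability. -/
def h2avg (d : ℕ) (lam : ℝ) (F : Measure ℝ) (G : Kernel ℝ ℝ) (u r₁ r₂ : ℝ) : ℝ :=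
  ∫ w₁, ∫ w₂, h2ret d lam F G u r₁ w₁ r₂ w₂ ∂(G r₂) ∂(G r₁)

/-- Retention covariance function `q(u,r₁,r₂) = h₂(u,r₁,r₂) - h(r₁) h(r₂)`. -/
def qret (d : ℕ) (lam : ℝ) (F : Measure ℝ) (G : Kernel ℝ ℝ) (u r₁ r₂ : ℝ) : ℝ :=
  h2avg d lam F G u r₁ r₂ - havg d lam F G r₁ * havg d lam F G r₂

/-- Thinned germ density `λ_th = λ ∫ h(r) F(dr)`. -/
def lamth (lam : ℝ) (F : Measure ℝ) (h : ℝ → ℝ) : ℝ := lam * ∫ r, h r ∂F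

/-- Tail distribution `F̄_th(r) = (λ/λ_th) ∫_{(r,∞)} h(s) F(ds)` of the radius of a
typical grain in the thinned model. -/
def tailth (lam : ℝ) (F : Measure ℝ) (h : ℝ → ℝ) (r : ℝ) : ℝ :=
  (lam / lamth lam F h) * ∫ s in Ioi r, h s ∂F

/-- Volume fraction `p_th = λ ∫ |B_r(0)| h(r) F(dr)` of the thinned grain cover. -/
def pth (d : ℕ) (lam : ℝ) (F : Measure ℝ) (h : ℝ → ℝ) : ℝ :=
  lam * ∫ r, ballVol d r * h r ∂F

/-- Covariance function of the thinned grain cover. -/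
def kth (d : ℕ) (lam : ℝ) (F : Measure ℝ) (h : ℝ → ℝ) (q : ℝ → ℝ → ℝ → ℝ)
    (z : Euc d) : ℝ :=
  lam * ∫ r, interVol d 0 r z r * h r ∂F +
    lam ^ 2 * ∫ r₁, (∫ r₂, (∫ x, interVol d 0 r₁ x r₂ * q (‖x - z‖) r₁ r₂) ∂F) ∂F

/-- Two-point correlation function of the thinned grain centers. -/
def xith (d : ℕ) (lam : ℝ) (F : Measure ℝ) (h : ℝ → ℝ) (q : ℝ → ℝ → ℝ → ℝ)
    (z : Euc d) : ℝ :=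
  (lam / lamth lam F h) ^ 2 * ∫ r₁, (∫ r₂, q ‖z‖ r₁ r₂ ∂F) ∂F

/-! ### Geometry -/

lemma finrank_euc (d : ℕ) : Module.finrank ℝ (Euc d) = d := by simp

lemma ballVol_nonneg (d : ℕ) (r : ℝ) : 0 ≤ ballVol d r := ENNReal.toReal_nonneg

lemma interVol_nonneg (d : ℕ) (x : Euc d) (r : ℝ) (y : Euc d) (s : ℝ) :
    0 ≤ interVol d x r y s := ENNReal.toReal_nonneg

lemma ballVol_eq (d : ℕ) {r : ℝ} (hr : 0 ≤ r) : ballVol d r = ballVol d 1 * r ^ d := by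
  unfold ballVol
  rw [Measure.addHaar_closedBall' volume (0 : Euc d) hr, ENNReal.toReal_mul,
    ENNReal.toReal_ofReal (by positivity), finrank_euc, mul_comm]

lemma ballVol_center (d : ℕ) (x : Euc d) (r : ℝ) :
    (volume (closedBall x r)).toReal = ballVol d r := by
  unfold ballVol
  rw [Measure.addHaar_closedBall_center]

lemma interVol_le_left (d : ℕ) (x : Euc d) (r : ℝ) (y : Euc d) (s : ℝ) :
    interVol d x r y s ≤ ballVol d r := by
  rw [← ballVol_center d x r]
  exact ENNReal.toReal_mono measure_closedBall_lt_top.ne (measure_mono inter_subset_left)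

lemma interVol_le_right (d : ℕ) (x : Euc d) (r : ℝ) (y : Euc d) (s : ℝ) :
    interVol d x r y s ≤ ballVol d s := by
  rw [← ballVol_center d y s]
  exact ENNReal.toReal_mono measure_closedBall_lt_top.ne (measure_mono inter_subset_right)

lemma interVol_eq_zero (d : ℕ) (x : Euc d) (r : ℝ) (y : Euc d) (s : ℝ) (h : r + s < dist x y) :
    interVol d x r y s = 0 := by
  unfold interVol
  have : closedBall x r ∩ closedBall y s = ∅ := by
    rw [← Set.disjoint_iff_inter_eq_empty]
    exact closedBall_disjoint_closedBall h
  simp [this]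

lemma measurable_interVol (d : ℕ) :
    Measurable (fun p : (Euc d × ℝ) × (Euc d × ℝ) => interVol d p.1.1 p.1.2 p.2.1 p.2.2) := by
  unfold interVol
  apply Measurable.ennreal_toReal
  have hs : MeasurableSet {q : ((Euc d × ℝ) × (Euc d × ℝ)) × Euc d |
      dist q.2 q.1.1.1 ≤ q.1.1.2 ∧ dist q.2 q.1.2.1 ≤ q.1.2.2} := by
    have ha : MeasurableSet {q : ((Euc d × ℝ) × (Euc d × ℝ)) × Euc d | dist q.2 q.1.1.1 ≤ q.1.1.2} :=
      measurableSet_le (by fun_prop) (by fun_prop)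
    have hb : MeasurableSet {q : ((Euc d × ℝ) × (Euc d × ℝ)) × Euc d | dist q.2 q.1.2.1 ≤ q.1.2.2} :=
      measurableSet_le (by fun_prop) (by fun_prop)
    exact ha.inter hb
  exact measurable_measure_prodMk_left (ν := (volume : Measure (Euc d))) hs

lemma meas_interVol {T : Type*} [MeasurableSpace T] (d : ℕ) {a c : T → Euc d} {b e : T → ℝ}
    (ha : Measurable a) (hb : Measurable b) (hc : Measurable c) (he : Measurable e) :
    Measurable (fun t => interVol d (a t) (b t) (c t) (e t)) := by
  have h : Measurable (fun t => ((a t, b t), (c t, e t))) := (ha.prodMk hb).prodMk (hc.prodMk he)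
  have h2 := (measurable_interVol d).comp h
  simpa only [Function.comp_def] using h2

lemma measurable_ballVol (d : ℕ) : Measurable (ballVol d) := by
  have : ballVol d = fun r => interVol d 0 r 0 r := by
    ext r; simp [ballVol, interVol]
  rw [this]
  exact meas_interVol d measurable_const measurable_id measurable_const measurable_id

lemma lintegral_interVol (d : ℕ) (r s : ℝ) :
    ∫⁻ x : Euc d, volume (closedBall (0 : Euc d) r ∩ closedBall x s)
      = volume (closedBall (0 : Euc d) s) * volume (closedBall (0 : Euc d) r) := by
  have hs : MeasurableSet {q : Euc d × Euc d | dist q.2 0 ≤ r ∧ dist q.2 q.1 ≤ s} := by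
    have ha : MeasurableSet {q : Euc d × Euc d | dist q.2 0 ≤ r} :=
      measurableSet_le (by fun_prop) (by fun_prop)
    have hb : MeasurableSet {q : Euc d × Euc d | dist q.2 q.1 ≤ s} :=
      measurableSet_le (by fun_prop) (by fun_prop)
    exact ha.inter hb
  have h1 := Measure.prod_apply (μ := (volume : Measure (Euc d)))
    (ν := (volume : Measure (Euc d))) hs
  have h2 := Measure.prod_apply_symm (μ := (volume : Measure (Euc d)))
    (ν := (volume : Measure (Euc d))) hs
  rw [h1] at h2
  refine h2.trans ?_
  have : ∀ y : Euc d, volume ((fun x => (x, y)) ⁻¹'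
      {q : Euc d × Euc d | dist q.2 0 ≤ r ∧ dist q.2 q.1 ≤ s})
      = (closedBall (0 : Euc d) r).indicator (fun _ => volume (closedBall (0 : Euc d) s)) y := by
    intro y
    by_cases hy : dist y 0 ≤ r
    · rw [indicator_of_mem (by simpa using hy), ← Measure.addHaar_closedBall_center volume y s]
      congr 1
      ext x
      simp only [mem_preimage, mem_ofPred_eq, mem_closedBall, hy, true_and, dist_comm]
    · rw [indicator_of_notMem (by simpa using hy)]
      convert measure_empty (μ := (volume : Measure (Euc d)))
      ext x
      simp only [mem_preimage, mem_ofPred_eq, hy, false_and, mem_empty_iff_false]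
  simp_rw [this]
  rw [lintegral_indicator measurableSet_closedBall, setLIntegral_const]

lemma integral_interVol (d : ℕ) (r s : ℝ) :
    Integrable (fun x : Euc d => interVol d 0 r x s) ∧
    ∫ x : Euc d, interVol d 0 r x s = ballVol d r * ballVol d s := by
  have hm : AEMeasurable (fun x : Euc d => volume (closedBall (0 : Euc d) r ∩ closedBall x s))
      volume := by
    have hs : MeasurableSet {q : Euc d × Euc d | dist q.2 0 ≤ r ∧ dist q.2 q.1 ≤ s} := by
      have ha : MeasurableSet {q : Euc d × Euc d | dist q.2 0 ≤ r} :=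
        measurableSet_le (by fun_prop) (by fun_prop)
      have hb : MeasurableSet {q : Euc d × Euc d | dist q.2 q.1 ≤ s} :=
        measurableSet_le (by fun_prop) (by fun_prop)
      exact ha.inter hb
    exact (measurable_measure_prodMk_left (ν := (volume : Measure (Euc d))) hs).aemeasurable
  have hne : ∫⁻ x : Euc d, volume (closedBall (0 : Euc d) r ∩ closedBall x s) ≠ ⊤ := by
    rw [lintegral_interVol]
    exact ENNReal.mul_ne_top measure_closedBall_lt_top.ne measure_closedBall_lt_top.ne
  constructor
  · exact integrable_toReal_of_lintegral_ne_top hm hne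
  · unfold interVol ballVol
    rw [integral_toReal hm (Eventually.of_forall fun x =>
      (measure_mono inter_subset_left).trans_lt measure_closedBall_lt_top),
      lintegral_interVol, ENNReal.toReal_mul, mul_comm]

/-! ### Measurability -/

lemma measurable_Gw (G : Kernel ℝ ℝ) [IsMarkovKernel G] :
    Measurable (fun p : ℝ × ℝ => ((G p.1) (Ici p.2)).toReal) := by
  apply Measurable.ennreal_toReal
  have hs : MeasurableSet {q : (ℝ × ℝ) × ℝ | q.1.2 ≤ q.2} :=
    measurableSet_le (by fun_prop) (by fun_prop)
  exact Kernel.measurable_kernel_prodMk_left (κ := G.prodMkRight ℝ) hs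

lemma meas_Gw {T : Type*} [MeasurableSpace T] (G : Kernel ℝ ℝ) [IsMarkovKernel G] {a b : T → ℝ}
    (ha : Measurable a) (hb : Measurable b) :
    Measurable (fun t => ((G (a t)) (Ici (b t))).toReal) := by
  have h2 := (measurable_Gw G).comp (ha.prodMk hb)
  simpa only [Function.comp_def] using h2

lemma Gw_nonneg (G : Kernel ℝ ℝ) (r w : ℝ) : 0 ≤ ((G r) (Ici w)).toReal :=
  ENNReal.toReal_nonneg

lemma Gw_le_one (G : Kernel ℝ ℝ) [IsMarkovKernel G] (r w : ℝ) : ((G r) (Ici w)).toReal ≤ 1 :=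
  measureReal_le_one

lemma Gw_anti (G : Kernel ℝ ℝ) [IsMarkovKernel G] (r : ℝ) {w w' : ℝ} (h : w ≤ w') :
    ((G r) (Ici w')).toReal ≤ ((G r) (Ici w)).toReal :=
  measureReal_mono (Ici_subset_Ici.2 h)

lemma measurable_hret (d : ℕ) (lam : ℝ) (F : Measure ℝ) [IsProbabilityMeasure F]
    (G : Kernel ℝ ℝ) [IsMarkovKernel G] :
    Measurable (fun p : ℝ × ℝ => hret d lam F G p.1 p.2) := by
  unfold hret
  apply Real.measurable_exp.comp
  apply Measurable.neg
  apply Measurable.const_mul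
  have : Measurable (fun q : (ℝ × ℝ) × ℝ =>
      ballVol d (q.1.1 + q.2) * ((G q.2) (Ici q.1.2)).toReal) :=
    ((measurable_ballVol d).comp (by fun_prop : Measurable fun q : (ℝ × ℝ) × ℝ => q.1.1 + q.2)).mul
      (meas_Gw G (by fun_prop) (by fun_prop))
  exact this.stronglyMeasurable.integral_prod_right'.measurable

lemma meas_hret {T : Type*} [MeasurableSpace T] (d : ℕ) (lam : ℝ) (F : Measure ℝ)
    [IsProbabilityMeasure F] (G : Kernel ℝ ℝ) [IsMarkovKernel G] {a b : T → ℝ}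
    (ha : Measurable a) (hb : Measurable b) :
    Measurable (fun t => hret d lam F G (a t) (b t)) := by
  have h2 := (measurable_hret d lam F G).comp (ha.prodMk hb)
  simpa only [Function.comp_def] using h2

lemma measurable_havg (d : ℕ) (lam : ℝ) (F : Measure ℝ) [IsProbabilityMeasure F]
    (G : Kernel ℝ ℝ) [IsMarkovKernel G] : Measurable (havg d lam F G) := by
  unfold havg
  exact ((measurable_hret d lam F G).stronglyMeasurable.integral_kernel_prod_right'
    (κ := G)).measurable

lemma measurable_pairInt (d : ℕ) (F : Measure ℝ) [IsProbabilityMeasure F]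
    (G : Kernel ℝ ℝ) [IsMarkovKernel G] :
    Measurable (fun p : ((ℝ × ℝ × ℝ) × ℝ) × ℝ =>
      ∫ r, interVol d 0 (r + p.1.1.2.1) (p.1.1.1 • e1 d) (r + p.1.1.2.2) *
        ((G r) (Ici (max p.1.2 p.2))).toReal ∂F) := by
  have : Measurable (fun q : (((ℝ × ℝ × ℝ) × ℝ) × ℝ) × ℝ =>
      interVol d 0 (q.2 + q.1.1.1.2.1) (q.1.1.1.1 • e1 d) (q.2 + q.1.1.1.2.2) *
        ((G q.2) (Ici (max q.1.1.2 q.1.2))).toReal) := by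
    apply Measurable.mul
    · exact meas_interVol d (by fun_prop) (by fun_prop) (by fun_prop) (by fun_prop)
    · exact meas_Gw G (by fun_prop) (by fun_prop)
  exact this.stronglyMeasurable.integral_prod_right'.measurable

lemma measurable_h2ret (d : ℕ) (lam : ℝ) (F : Measure ℝ) [IsProbabilityMeasure F]
    (G : Kernel ℝ ℝ) [IsMarkovKernel G] :
    Measurable (fun p : ((ℝ × ℝ × ℝ) × ℝ) × ℝ =>
      h2ret d lam F G p.1.1.1 p.1.1.2.1 p.1.2 p.1.1.2.2 p.2) := by
  unfold h2ret
  apply Measurable.ite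
  · exact measurableSet_le (by fun_prop) (by fun_prop)
  · fun_prop
  · apply Measurable.mul
    · apply Measurable.mul
      · exact meas_hret d lam F G (by fun_prop) (by fun_prop)
      · exact meas_hret d lam F G (by fun_prop) (by fun_prop)
    · exact Real.measurable_exp.comp ((measurable_pairInt d F G).const_mul lam)

lemma measurable_h2avg (d : ℕ) (lam : ℝ) (F : Measure ℝ) [IsProbabilityMeasure F]
    (G : Kernel ℝ ℝ) [IsMarkovKernel G] :
    Measurable (fun p : ℝ × ℝ × ℝ => h2avg d lam F G p.1 p.2.1 p.2.2) := by
  unfold h2avg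
  have h1 : StronglyMeasurable (fun p : (ℝ × ℝ × ℝ) × ℝ =>
      ∫ w₂, h2ret d lam F G p.1.1 p.1.2.1 p.2 p.1.2.2 w₂ ∂(G p.1.2.2)) :=
    (measurable_h2ret d lam F G).stronglyMeasurable.integral_kernel_prod_right'
      (κ := G.comap (fun p : (ℝ × ℝ × ℝ) × ℝ => p.1.2.2) (by fun_prop))
  exact (h1.integral_kernel_prod_right'
      (κ := G.comap (fun p : ℝ × ℝ × ℝ => p.2.1) (by fun_prop))).measurable

lemma measurable_qret (d : ℕ) (lam : ℝ) (F : Measure ℝ) [IsProbabilityMeasure F]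
    (G : Kernel ℝ ℝ) [IsMarkovKernel G] :
    Measurable (fun p : ℝ × ℝ × ℝ => qret d lam F G p.1 p.2.1 p.2.2) := by
  unfold qret
  exact (measurable_h2avg d lam F G).sub
    (((measurable_havg d lam F G).comp (by fun_prop)).mul
      ((measurable_havg d lam F G).comp (by fun_prop)))

lemma meas_qret {T : Type*} [MeasurableSpace T] (d : ℕ) (lam : ℝ) (F : Measure ℝ)
    [IsProbabilityMeasure F] (G : Kernel ℝ ℝ) [IsMarkovKernel G] {a b c : T → ℝ}
    (ha : Measurable a) (hb : Measurable b) (hc : Measurable c) :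
    Measurable (fun t => qret d lam F G (a t) (b t) (c t)) := by
  have h2 := (measurable_qret d lam F G).comp (ha.prodMk (hb.prodMk hc))
  simpa only [Function.comp_def] using h2

/-- The inner spatial integral. -/
def innerInt (d : ℕ) (q : ℝ → ℝ → ℝ → ℝ) (z : Euc d) (p : ℝ × ℝ) : ℝ :=
  ∫ x : Euc d, interVol d 0 p.1 x p.2 * q (‖x - z‖) p.1 p.2

lemma measurable_integrand (d : ℕ) (lam : ℝ) (F : Measure ℝ) [IsProbabilityMeasure F]
    (G : Kernel ℝ ℝ) [IsMarkovKernel G] (z : Euc d) :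
    Measurable (fun p : (ℝ × ℝ) × Euc d =>
      interVol d 0 p.1.1 p.2 p.1.2 * qret d lam F G (‖p.2 - z‖) p.1.1 p.1.2) := by
  apply Measurable.mul
  · exact meas_interVol d (by fun_prop) (by fun_prop) (by fun_prop) (by fun_prop)
  · exact meas_qret d lam F G (by fun_prop) (by fun_prop) (by fun_prop)

lemma measurable_innerInt (d : ℕ) (lam : ℝ) (F : Measure ℝ) [IsProbabilityMeasure F]
    (G : Kernel ℝ ℝ) [IsMarkovKernel G] (z : Euc d) :
    Measurable (innerInt d (qret d lam F G) z) :=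
  (measurable_integrand d lam F G z).stronglyMeasurable.integral_prod_right'.measurable

/-! ### Tail analysis -/

/-- The normalisation `F̄(x) x^d`. -/
def gtail (d : ℕ) (F : Measure ℝ) (x : ℝ) : ℝ := tailF F x * x ^ d

/-- Truncated moment. -/
def Mtail (d : ℕ) (F : Measure ℝ) (x : ℝ) : ℝ := ∫ r in Ioi x, r ^ d ∂F

lemma tailF_anti (F : Measure ℝ) [IsProbabilityMeasure F] {x y : ℝ} (h : x ≤ y) :
    tailF F y ≤ tailF F x :=
  measureReal_mono (Ioi_subset_Ioi h)

lemma tailF_pos (F : Measure ℝ) {α : ℝ} (hpow : IsPowerLaw F α) {x : ℝ} (hx : 0 < x) :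
    0 < tailF F x := by
  obtain ⟨l, ⟨_, hl, _⟩, h⟩ := hpow
  rw [h x hx]
  exact mul_pos (hl x hx) (Real.rpow_pos_of_pos hx _)

lemma gtail_pos (d : ℕ) (F : Measure ℝ) {α : ℝ} (hpow : IsPowerLaw F α) {x : ℝ} (hx : 0 < x) :
    0 < gtail d F x := mul_pos (tailF_pos F hpow hx) (pow_pos hx d)

lemma tail_ratio (F : Measure ℝ) {α : ℝ} (hpow : IsPowerLaw F α) {c : ℝ} (hc : 0 < c) :
    Tendsto (fun t => tailF F (c * t) / tailF F t) atTop (nhds (c ^ (-α))) := by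
  obtain ⟨l, ⟨_, hl, hs⟩, h⟩ := hpow
  have h1 := (hs c hc).mul_const (c ^ (-α))
  rw [one_mul] at h1
  refine h1.congr' ?_
  filter_upwards [eventually_gt_atTop 0] with t ht
  rw [h t ht, h (c * t) (by positivity), Real.mul_rpow hc.le ht.le]
  have := hl t ht
  have h3 := Real.rpow_pos_of_pos ht (-α)
  field_simp

lemma tail_shift (F : Measure ℝ) [IsProbabilityMeasure F] {α : ℝ} (hpow : IsPowerLaw F α)
    {ι : Type*} {L : Filter ι} {s t : ι → ℝ} (ht : Tendsto t L atTop)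
    (hst : Tendsto (fun i => s i / t i) L (nhds 1)) :
    Tendsto (fun i => tailF F (s i) / tailF F (t i)) L (nhds 1) := by
  have hcont : Tendsto (fun c : ℝ => c ^ (-α)) (nhds 1) (nhds 1) := by
    have := (Real.continuousAt_rpow_const 1 (-α) (Or.inl one_ne_zero)).tendsto
    simpa using this
  rw [tendsto_order]
  constructor
  · intro a ha
    obtain ⟨c, hc1, hca⟩ : ∃ c : ℝ, 1 < c ∧ a < c ^ (-α) := by
      have h1 : ∀ᶠ c : ℝ in nhdsWithin 1 (Ioi 1), a < c ^ (-α) :=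
        (hcont.mono_left nhdsWithin_le_nhds).eventually (lt_mem_nhds ha)
      obtain ⟨c, hc⟩ := (h1.and self_mem_nhdsWithin).exists
      exact ⟨c, hc.2, hc.1⟩
    have h2 := ((tail_ratio F hpow (by linarith : 0 < c)).comp ht).eventually (lt_mem_nhds hca)
    filter_upwards [h2, ht.eventually_gt_atTop 0, hst.eventually (gt_mem_nhds hc1)] with i h2 h3 h4
    refine lt_of_lt_of_le h2 ?_
    have := tailF_pos F hpow h3
    simp only [Function.comp]
    gcongr
    apply tailF_anti
    rw [div_lt_iff₀ h3] at h4
    exact h4.le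
  · intro a ha
    obtain ⟨c, hc0, hc1, hca⟩ : ∃ c : ℝ, 0 < c ∧ c < 1 ∧ c ^ (-α) < a := by
      have h1 : ∀ᶠ c : ℝ in nhdsWithin 1 (Iio 1), c ^ (-α) < a :=
        (hcont.mono_left nhdsWithin_le_nhds).eventually (gt_mem_nhds ha)
      have h0 : ∀ᶠ c : ℝ in nhdsWithin 1 (Iio 1), 0 < c :=
        nhdsWithin_le_nhds (lt_mem_nhds one_pos)
      obtain ⟨c, hc⟩ := ((h1.and h0).and self_mem_nhdsWithin).exists
      exact ⟨c, hc.1.2, hc.2, hc.1.1⟩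
    have h2 := ((tail_ratio F hpow hc0).comp ht).eventually (gt_mem_nhds hca)
    filter_upwards [h2, ht.eventually_gt_atTop 0, hst.eventually (lt_mem_nhds hc1)] with i h2 h3 h4
    refine lt_of_le_of_lt ?_ h2
    have := tailF_pos F hpow h3
    simp only [Function.comp]
    gcongr
    apply tailF_anti
    rw [lt_div_iff₀ h3] at h4
    exact h4.le

lemma tendsto_norm_sub_div (d : ℕ) (x : Euc d) :
    Tendsto (fun z : Euc d => ‖x - z‖ / ‖z‖) (comap norm atTop) (nhds 1) := by
  have h1 : Tendsto (fun z : Euc d => ‖z‖) (comap norm atTop) atTop := tendsto_comap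
  have h2 : Tendsto (fun z : Euc d => ‖x‖ / ‖z‖) (comap norm atTop) (nhds 0) :=
    h1.const_div_atTop _
  have h3 : Tendsto (fun z : Euc d => ‖x - z‖ / ‖z‖ - 1) (comap norm atTop) (nhds 0) := by
    apply squeeze_zero_norm' _ h2
    filter_upwards [h1.eventually_gt_atTop 0] with z hz
    have : ‖x - z‖ / ‖z‖ - 1 = (‖x - z‖ - ‖z‖) / ‖z‖ := by field_simp
    rw [this, norm_div, norm_norm, Real.norm_eq_abs]
    gcongr
    have := abs_norm_sub_norm_le (x - z) (-z)
    simpa using this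
  simpa using h3.add_const 1

lemma g_shift (d : ℕ) (F : Measure ℝ) [IsProbabilityMeasure F] {α : ℝ} (hpow : IsPowerLaw F α)
    (x : Euc d) :
    Tendsto (fun z : Euc d => gtail d F ‖x - z‖ / gtail d F ‖z‖) (comap norm atTop) (nhds 1) := by
  have h1 : Tendsto (fun z : Euc d => ‖z‖) (comap norm atTop) atTop := tendsto_comap
  have h := (tail_shift F hpow h1 (tendsto_norm_sub_div d x)).mul
    ((tendsto_norm_sub_div d x).pow d)
  simp only [one_pow, mul_one] at h
  refine h.congr fun z => ?_
  rw [gtail, gtail, div_pow, mul_div_mul_comm]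

lemma Mtail_step (d : ℕ) (F : Measure ℝ) [IsProbabilityMeasure F]
    (hmom : Integrable (fun r : ℝ => r ^ d) F) {x : ℝ} (hx : 0 < x) :
    Mtail d F x ≤ 2 ^ d * gtail d F x + Mtail d F (2 * x) := by
  unfold Mtail
  have hu : Ioi x = Ioc x (2 * x) ∪ Ioi (2 * x) := (Ioc_union_Ioi_eq_Ioi (by linarith)).symm
  rw [hu, setIntegral_union (Ioc_disjoint_Ioi le_rfl) measurableSet_Ioi hmom.integrableOn
    hmom.integrableOn]
  gcongr
  calc ∫ r in Ioc x (2 * x), r ^ d ∂F ≤ ∫ r in Ioc x (2 * x), (2 * x) ^ d ∂F := by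
        apply setIntegral_mono_on hmom.integrableOn (integrable_const _).integrableOn
          measurableSet_Ioc
        intro r hr
        have : 0 ≤ r := (hx.trans hr.1).le
        exact pow_le_pow_left₀ this hr.2 d
    _ = F.real (Ioc x (2 * x)) * (2 * x) ^ d := by simp
    _ ≤ tailF F x * (2 * x) ^ d := by
        gcongr
        exact measureReal_mono Ioc_subset_Ioi_self
    _ = _ := by rw [gtail, mul_pow]; ring

lemma Mtail_tendsto (d : ℕ) (F : Measure ℝ) [IsProbabilityMeasure F]
    (hmom : Integrable (fun r : ℝ => r ^ d) F) :
    Tendsto (Mtail d F) atTop (nhds 0) := by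
  have h := tendsto_setIntegral_of_antitone (μ := F) (f := fun r : ℝ => r ^ d)
    (s := fun x : ℝ => Ioi x) (fun _ => measurableSet_Ioi) (fun a b h => Ioi_subset_Ioi h)
    ⟨0, hmom.integrableOn⟩
  have : ⋂ n : ℝ, Ioi n = ∅ := by
    ext y; simp only [mem_iInter, mem_Ioi, mem_empty_iff_false, iff_false, not_forall, not_lt]
    exact ⟨y, le_rfl⟩
  rw [this] at h
  have h' : Tendsto (fun x : ℝ => ∫ r in Ioi x, r ^ d ∂F) atTop (nhds 0) := by simpa using h
  exact h'

lemma Mtail_le (d : ℕ) (F : Measure ℝ) [IsProbabilityMeasure F]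
    (hmom : Integrable (fun r : ℝ => r ^ d) F)
    {α : ℝ} (hα : (d : ℝ) < α) (hpow : IsPowerLaw F α) :
    ∃ K > 0, ∀ᶠ x in atTop, Mtail d F x ≤ K * gtail d F x := by
  have h1 : Tendsto (fun t => gtail d F (2 * t) / gtail d F t) atTop
      (nhds (2 ^ (-α) * 2 ^ d)) := by
    refine ((tail_ratio F hpow two_pos).mul_const (2 ^ d)).congr' ?_
    filter_upwards [eventually_gt_atTop 0] with t ht
    have := tailF_pos F hpow ht
    rw [gtail, gtail, mul_pow]
    field_simp
  have hlt : (2 : ℝ) ^ (-α) * 2 ^ d < 1 := by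
    rw [← Real.rpow_natCast, ← Real.rpow_add two_pos]
    exact Real.rpow_lt_one_of_one_lt_of_neg one_lt_two (by linarith)
  obtain ⟨ρ, hρ1, hρ2⟩ := exists_between hlt
  have hρ0 : 0 < ρ := lt_trans (by positivity) hρ1
  obtain ⟨x0, hx0⟩ := eventually_atTop.1 (h1.eventually (gt_mem_nhds hρ1))
  have hK : 0 < 2 ^ d / (1 - ρ) := div_pos (by positivity) (by linarith)
  refine ⟨2 ^ d / (1 - ρ), hK, ?_⟩
  have key : ∀ n : ℕ, ∀ x, x0 ≤ x → 0 < x →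
      Mtail d F x ≤ 2 ^ d / (1 - ρ) * gtail d F x + Mtail d F (2 ^ n * x) := by
    intro n
    induction n with
    | zero =>
      intro x _ hx
      have := mul_pos hK (gtail_pos d F hpow hx)
      simp only [pow_zero, one_mul]; linarith
    | succ n ih =>
      intro x hx hx'
      have i1 := Mtail_step d F hmom hx'
      have i2 := ih (2 * x) (by linarith) (by linarith)
      have i3 := hx0 x hx
      have hg := gtail_pos d F hpow hx'
      rw [div_lt_iff₀ hg] at i3
      have i4 : 2 ^ d / (1 - ρ) * gtail d F (2 * x) ≤ 2 ^ d / (1 - ρ) * (ρ * gtail d F x) := by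
        gcongr
      have i5 : 2 ^ d * gtail d F x + 2 ^ d / (1 - ρ) * (ρ * gtail d F x)
          = 2 ^ d / (1 - ρ) * gtail d F x := by
        have : 1 - ρ ≠ 0 := by linarith
        field_simp; ring
      have i6 : (2 : ℝ) ^ (n + 1) * x = 2 ^ n * (2 * x) := by ring
      rw [i6]; linarith
  filter_upwards [eventually_ge_atTop x0, eventually_gt_atTop 0] with x hx hx'
  have hlim : Tendsto (fun n : ℕ => 2 ^ d / (1 - ρ) * gtail d F x + Mtail d F (2 ^ n * x)) atTop
      (nhds (2 ^ d / (1 - ρ) * gtail d F x + 0)) := by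
    apply Tendsto.const_add
    apply (Mtail_tendsto d F hmom).comp
    exact (tendsto_pow_atTop_atTop_of_one_lt one_lt_two).atTop_mul_const hx'
  rw [add_zero] at hlim
  exact ge_of_tendsto' hlim fun n => key n x hx hx'

lemma Mtail_le8 (d : ℕ) (F : Measure ℝ) [IsProbabilityMeasure F]
    (hmom : Integrable (fun r : ℝ => r ^ d) F)
    {α : ℝ} (hα : (d : ℝ) < α) (hpow : IsPowerLaw F α) :
    ∃ K > 0, ∀ᶠ x in atTop, Mtail d F (x / 8) ≤ K * gtail d F x := by
  obtain ⟨K, hK, h⟩ := Mtail_le d F hmom hα hpow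
  have hdiv : Tendsto (fun x : ℝ => x / 8) atTop atTop :=
    tendsto_id.atTop_div_const (by norm_num)
  have h8 := tail_ratio F hpow (c := 1 / 8) (by norm_num)
  set A : ℝ := (1 / 8 : ℝ) ^ (-α) with hA
  have hA0 : 0 < A := Real.rpow_pos_of_pos (by norm_num) _
  refine ⟨K * (A + 1), by positivity, ?_⟩
  filter_upwards [hdiv.eventually h, h8.eventually (gt_mem_nhds (lt_add_one A)),
    eventually_gt_atTop 0] with x h1 h2 hx
  rw [div_lt_iff₀ (tailF_pos F hpow hx)] at h2
  refine h1.trans ?_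
  rw [mul_assoc]
  gcongr
  rw [gtail, gtail, ← mul_assoc]
  have hT := tailF_pos F hpow hx
  have e : 1 / 8 * x = x / 8 := by ring
  rw [e] at h2
  gcongr
  linarith

/-! ### Bounds on the retention functions -/

lemma ae_nonneg_of_supp {F : Measure ℝ} (hsupp : F (Iio 0) = 0) : ∀ᵐ r ∂F, 0 ≤ r := by
  rw [ae_iff]
  convert hsupp using 2
  ext r; simp

lemma integrable_ballVol_add (d : ℕ) (F : Measure ℝ) [IsProbabilityMeasure F]
    (hsupp : F (Iio 0) = 0) (hmom : Integrable (fun r : ℝ => r ^ d) F) {r : ℝ} (hr : 0 ≤ r) :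
    Integrable (fun s => ballVol d (s + r)) F := by
  have hb : Integrable (fun s => ballVol d 1 * (2 ^ d * (s ^ d + r ^ d))) F :=
    ((hmom.add (integrable_const _)).const_mul _).const_mul _
  refine hb.mono' ((measurable_ballVol d).comp (by fun_prop)).aestronglyMeasurable ?_
  filter_upwards [ae_nonneg_of_supp hsupp] with s hs
  rw [Real.norm_of_nonneg (ballVol_nonneg _ _), ballVol_eq d (by linarith)]
  have := ballVol_nonneg d 1
  gcongr
  calc (s + r) ^ d ≤ (2 * max s r) ^ d := by
        gcongr
        linarith [le_max_left s r, le_max_right s r]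
    _ = 2 ^ d * (max s r) ^ d := by rw [mul_pow]
    _ ≤ 2 ^ d * (s ^ d + r ^ d) := by
        gcongr
        rcases le_total s r with h | h
        · rw [max_eq_right h]; linarith [pow_nonneg hs d]
        · rw [max_eq_left h]; linarith [pow_nonneg hr d]

lemma integrable_ballVol_G (d : ℕ) (F : Measure ℝ) [IsProbabilityMeasure F]
    (hsupp : F (Iio 0) = 0) (hmom : Integrable (fun r : ℝ => r ^ d) F)
    (G : Kernel ℝ ℝ) [IsMarkovKernel G] {r : ℝ} (hr : 0 ≤ r) (w : ℝ) :
    Integrable (fun s => ballVol d (s + r) * ((G s) (Ici w)).toReal) F := by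
  refine (integrable_ballVol_add d F hsupp hmom hr).mono' ?_ ?_
  · exact (((measurable_ballVol d).comp (by fun_prop)).mul
      (meas_Gw G measurable_id measurable_const)).aestronglyMeasurable
  · filter_upwards with s
    rw [Real.norm_of_nonneg (mul_nonneg (ballVol_nonneg _ _) (Gw_nonneg _ _ _))]
    exact mul_le_of_le_one_right (ballVol_nonneg _ _) (Gw_le_one _ _ _)

lemma pair_nonneg (d : ℕ) (F : Measure ℝ) (G : Kernel ℝ ℝ) (u r₁ r₂ w : ℝ) :
    0 ≤ ∫ r, interVol d 0 (r + r₁) (u • e1 d) (r + r₂) * ((G r) (Ici w)).toReal ∂F :=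
  integral_nonneg fun _ => mul_nonneg (interVol_nonneg _ _ _ _ _) (Gw_nonneg _ _ _)

lemma hret_pos (d : ℕ) (lam : ℝ) (F : Measure ℝ) (G : Kernel ℝ ℝ) (r w : ℝ) :
    0 < hret d lam F G r w := Real.exp_pos _

lemma hret_le_one (d : ℕ) {lam : ℝ} (hlam : 0 < lam) (F : Measure ℝ) (G : Kernel ℝ ℝ) (r w : ℝ) :
    hret d lam F G r w ≤ 1 := by
  unfold hret
  rw [Real.exp_le_one_iff, neg_nonpos]
  exact mul_nonneg hlam.le (integral_nonneg fun _ =>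
    mul_nonneg (ballVol_nonneg _ _) (Gw_nonneg _ _ _))

lemma hret_exp_left (d : ℕ) {lam : ℝ} (hlam : 0 < lam) (F : Measure ℝ) [IsProbabilityMeasure F]
    (hsupp : F (Iio 0) = 0) (hmom : Integrable (fun r : ℝ => r ^ d) F)
    (G : Kernel ℝ ℝ) [IsMarkovKernel G] (u : ℝ) {r₁ r₂ : ℝ} (h1 : 0 ≤ r₁) (w₁ w₂ : ℝ) :
    hret d lam F G r₁ w₁ * Real.exp (lam * ∫ r, interVol d 0 (r + r₁) (u • e1 d) (r + r₂) *
        ((G r) (Ici (max w₁ w₂))).toReal ∂F) ≤ 1 := by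
  unfold hret
  rw [← Real.exp_add, Real.exp_le_one_iff]
  have : ∫ r, interVol d 0 (r + r₁) (u • e1 d) (r + r₂) *
        ((G r) (Ici (max w₁ w₂))).toReal ∂F ≤
        ∫ s, ballVol d (r₁ + s) * ((G s) (Ici w₁)).toReal ∂F := by
    simp_rw [add_comm r₁]
    apply integral_mono_of_nonneg
    · exact Eventually.of_forall fun _ => mul_nonneg (interVol_nonneg _ _ _ _ _) (Gw_nonneg _ _ _)
    · exact integrable_ballVol_G d F hsupp hmom G h1 w₁
    · exact Eventually.of_forall fun r => mul_le_mul (interVol_le_left _ _ _ _ _)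
        (Gw_anti G r (le_max_left _ _)) (Gw_nonneg _ _ _) (ballVol_nonneg _ _)
  nlinarith

lemma hret_exp_right (d : ℕ) {lam : ℝ} (hlam : 0 < lam) (F : Measure ℝ) [IsProbabilityMeasure F]
    (hsupp : F (Iio 0) = 0) (hmom : Integrable (fun r : ℝ => r ^ d) F)
    (G : Kernel ℝ ℝ) [IsMarkovKernel G] (u : ℝ) {r₁ r₂ : ℝ} (h2 : 0 ≤ r₂) (w₁ w₂ : ℝ) :
    hret d lam F G r₂ w₂ * Real.exp (lam * ∫ r, interVol d 0 (r + r₁) (u • e1 d) (r + r₂) *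
        ((G r) (Ici (max w₁ w₂))).toReal ∂F) ≤ 1 := by
  unfold hret
  rw [← Real.exp_add, Real.exp_le_one_iff]
  have : ∫ r, interVol d 0 (r + r₁) (u • e1 d) (r + r₂) *
        ((G r) (Ici (max w₁ w₂))).toReal ∂F ≤
        ∫ s, ballVol d (r₂ + s) * ((G s) (Ici w₂)).toReal ∂F := by
    simp_rw [add_comm r₂]
    apply integral_mono_of_nonneg
    · exact Eventually.of_forall fun _ => mul_nonneg (interVol_nonneg _ _ _ _ _) (Gw_nonneg _ _ _)
    · exact integrable_ballVol_G d F hsupp hmom G h2 w₂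
    · exact Eventually.of_forall fun r => mul_le_mul (interVol_le_right _ _ _ _ _)
        (Gw_anti G r (le_max_right _ _)) (Gw_nonneg _ _ _) (ballVol_nonneg _ _)
  nlinarith

lemma h2ret_nonneg (d : ℕ) (lam : ℝ) (F : Measure ℝ) (G : Kernel ℝ ℝ) (u r₁ w₁ r₂ w₂ : ℝ) :
    0 ≤ h2ret d lam F G u r₁ w₁ r₂ w₂ := by
  unfold h2ret
  split_ifs
  · exact le_rfl
  · exact mul_nonneg (mul_nonneg (hret_pos _ _ _ _ _ _).le (hret_pos _ _ _ _ _ _).le)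
      (Real.exp_pos _).le

lemma h2ret_le_left (d : ℕ) {lam : ℝ} (hlam : 0 < lam) (F : Measure ℝ) [IsProbabilityMeasure F]
    (hsupp : F (Iio 0) = 0) (hmom : Integrable (fun r : ℝ => r ^ d) F)
    (G : Kernel ℝ ℝ) [IsMarkovKernel G] (u : ℝ) {r₁ r₂ : ℝ} (h2 : 0 ≤ r₂) (w₁ w₂ : ℝ) :
    h2ret d lam F G u r₁ w₁ r₂ w₂ ≤ hret d lam F G r₁ w₁ := by
  unfold h2ret
  split_ifs
  · exact (hret_pos _ _ _ _ _ _).le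
  · rw [mul_assoc]
    exact mul_le_of_le_one_right (hret_pos _ _ _ _ _ _).le
      (hret_exp_right d hlam F hsupp hmom G u h2 w₁ w₂)

lemma h2ret_le_right (d : ℕ) {lam : ℝ} (hlam : 0 < lam) (F : Measure ℝ) [IsProbabilityMeasure F]
    (hsupp : F (Iio 0) = 0) (hmom : Integrable (fun r : ℝ => r ^ d) F)
    (G : Kernel ℝ ℝ) [IsMarkovKernel G] (u : ℝ) {r₁ r₂ : ℝ} (h1 : 0 ≤ r₁) (w₁ w₂ : ℝ) :
    h2ret d lam F G u r₁ w₁ r₂ w₂ ≤ hret d lam F G r₂ w₂ := by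
  unfold h2ret
  split_ifs
  · exact (hret_pos _ _ _ _ _ _).le
  · rw [mul_right_comm]
    exact mul_le_of_le_one_left (hret_pos _ _ _ _ _ _).le
      (hret_exp_left d hlam F hsupp hmom G u h1 w₁ w₂)

lemma dbl_mono (μ ν : Measure ℝ) [IsProbabilityMeasure μ] [IsProbabilityMeasure ν]
    {f g : ℝ → ℝ → ℝ} (hf : Measurable (Function.uncurry f)) (hg : Measurable (Function.uncurry g))
    {C : ℝ} (hf0 : ∀ a b, 0 ≤ f a b) (hfg : ∀ a b, f a b ≤ g a b) (hgC : ∀ a b, g a b ≤ C) :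
    ∫ a, ∫ b, f a b ∂ν ∂μ ≤ ∫ a, ∫ b, g a b ∂ν ∂μ := by
  have If : Integrable (Function.uncurry f) (μ.prod ν) := by
    refine Integrable.of_bound hf.aestronglyMeasurable C (Eventually.of_forall fun p => ?_)
    rw [Function.uncurry, Real.norm_of_nonneg (hf0 _ _)]
    exact (hfg _ _).trans (hgC _ _)
  have Ig : Integrable (Function.uncurry g) (μ.prod ν) := by
    refine Integrable.of_bound hg.aestronglyMeasurable C (Eventually.of_forall fun p => ?_)
    rw [Function.uncurry, Real.norm_of_nonneg ((hf0 _ _).trans (hfg _ _))]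
    exact hgC _ _
  have e1 := integral_prod _ If
  have e2 := integral_prod _ Ig
  simp only [Function.uncurry] at e1 e2
  rw [← e1, ← e2]
  exact integral_mono If Ig fun p => hfg p.1 p.2

lemma havg_nonneg (d : ℕ) (lam : ℝ) (F : Measure ℝ) (G : Kernel ℝ ℝ) (r : ℝ) :
    0 ≤ havg d lam F G r := integral_nonneg fun _ => (hret_pos _ _ _ _ _ _).le

lemma havg_le_one (d : ℕ) {lam : ℝ} (hlam : 0 < lam) (F : Measure ℝ)
    (G : Kernel ℝ ℝ) [IsMarkovKernel G] (r : ℝ) : havg d lam F G r ≤ 1 := by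
  have h : havg d lam F G r ≤ ∫ _, (1 : ℝ) ∂(G r) :=
    integral_mono_of_nonneg (Eventually.of_forall fun _ => (hret_pos _ _ _ _ _ _).le)
      (integrable_const _) (Eventually.of_forall fun _ => hret_le_one d hlam F G r _)
  simpa using h

lemma h2avg_nonneg (d : ℕ) (lam : ℝ) (F : Measure ℝ) (G : Kernel ℝ ℝ) (u r₁ r₂ : ℝ) :
    0 ≤ h2avg d lam F G u r₁ r₂ :=
  integral_nonneg fun _ => integral_nonneg fun _ => h2ret_nonneg _ _ _ _ _ _ _ _ _

lemma meas_h2ret (d : ℕ) (lam : ℝ) (F : Measure ℝ) [IsProbabilityMeasure F]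
    (G : Kernel ℝ ℝ) [IsMarkovKernel G] (u r₁ r₂ : ℝ) :
    Measurable (Function.uncurry fun w₁ w₂ => h2ret d lam F G u r₁ w₁ r₂ w₂) := by
  have h2 := (measurable_h2ret d lam F G).comp
    (by fun_prop : Measurable (fun p : ℝ × ℝ => (((u, r₁, r₂), p.1), p.2)))
  simpa only [Function.comp_def, Function.uncurry_def] using h2

lemma h2avg_le_left (d : ℕ) {lam : ℝ} (hlam : 0 < lam) (F : Measure ℝ) [IsProbabilityMeasure F]
    (hsupp : F (Iio 0) = 0) (hmom : Integrable (fun r : ℝ => r ^ d) F)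
    (G : Kernel ℝ ℝ) [IsMarkovKernel G] (u : ℝ) {r₁ r₂ : ℝ} (h2 : 0 ≤ r₂) :
    h2avg d lam F G u r₁ r₂ ≤ havg d lam F G r₁ := by
  have h := dbl_mono (G r₁) (G r₂) (meas_h2ret d lam F G u r₁ r₂)
    (g := fun w₁ _ => hret d lam F G r₁ w₁)
    (meas_hret d lam F G measurable_const measurable_fst)
    (fun _ _ => h2ret_nonneg _ _ _ _ _ _ _ _ _)
    (fun _ _ => h2ret_le_left d hlam F hsupp hmom G u h2 _ _)
    (fun _ _ => hret_le_one d hlam F G _ _)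
  simpa [h2avg, havg] using h

lemma h2avg_le_right (d : ℕ) {lam : ℝ} (hlam : 0 < lam) (F : Measure ℝ) [IsProbabilityMeasure F]
    (hsupp : F (Iio 0) = 0) (hmom : Integrable (fun r : ℝ => r ^ d) F)
    (G : Kernel ℝ ℝ) [IsMarkovKernel G] (u : ℝ) {r₁ r₂ : ℝ} (h1 : 0 ≤ r₁) :
    h2avg d lam F G u r₁ r₂ ≤ havg d lam F G r₂ := by
  have h := dbl_mono (G r₁) (G r₂) (meas_h2ret d lam F G u r₁ r₂)
    (g := fun _ w₂ => hret d lam F G r₂ w₂)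
    (meas_hret d lam F G measurable_const measurable_snd)
    (fun _ _ => h2ret_nonneg _ _ _ _ _ _ _ _ _)
    (fun _ _ => h2ret_le_right d hlam F hsupp hmom G u h1 _ _)
    (fun _ _ => hret_le_one d hlam F G _ _)
  simpa [h2avg, havg] using h

lemma qret_le_left (d : ℕ) {lam : ℝ} (hlam : 0 < lam) (F : Measure ℝ) [IsProbabilityMeasure F]
    (hsupp : F (Iio 0) = 0) (hmom : Integrable (fun r : ℝ => r ^ d) F)
    (G : Kernel ℝ ℝ) [IsMarkovKernel G] (u : ℝ) {r₁ r₂ : ℝ} (h2 : 0 ≤ r₂) :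
    |qret d lam F G u r₁ r₂| ≤ havg d lam F G r₁ := by
  have a := h2avg_nonneg d lam F G u r₁ r₂
  have b := h2avg_le_left d hlam F hsupp hmom G u (r₁ := r₁) h2
  have c := havg_nonneg d lam F G r₁
  have e := havg_nonneg d lam F G r₂
  have f := havg_le_one d hlam F G r₂
  rw [qret, abs_le]
  constructor <;> nlinarith

lemma qret_le_right (d : ℕ) {lam : ℝ} (hlam : 0 < lam) (F : Measure ℝ) [IsProbabilityMeasure F]
    (hsupp : F (Iio 0) = 0) (hmom : Integrable (fun r : ℝ => r ^ d) F)
    (G : Kernel ℝ ℝ) [IsMarkovKernel G] (u : ℝ) {r₁ r₂ : ℝ} (h1 : 0 ≤ r₁) :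
    |qret d lam F G u r₁ r₂| ≤ havg d lam F G r₂ := by
  have a := h2avg_nonneg d lam F G u r₁ r₂
  have b := h2avg_le_right d hlam F hsupp hmom G u (r₂ := r₂) h1
  have c := havg_nonneg d lam F G r₁
  have e := havg_nonneg d lam F G r₂
  have f := havg_le_one d hlam F G r₁
  rw [qret, abs_le]
  constructor <;> nlinarith

lemma qret_near (d : ℕ) {lam : ℝ} (hlam : 0 < lam) (F : Measure ℝ) [IsProbabilityMeasure F]
    (G : Kernel ℝ ℝ) [IsMarkovKernel G] {u r₁ r₂ J : ℝ} (hu : r₁ + r₂ < u)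
    (hJ : ∀ w, ∫ r, interVol d 0 (r + r₁) (u • e1 d) (r + r₂) * ((G r) (Ici w)).toReal ∂F ≤ J) :
    |qret d lam F G u r₁ r₂| ≤ Real.exp (lam * J) - 1 := by
  have hJ0 : 0 ≤ J := (pair_nonneg d F G u r₁ r₂ 0).trans (hJ 0)
  have hprod : ∫ w₁, ∫ w₂, hret d lam F G r₁ w₁ * hret d lam F G r₂ w₂ ∂(G r₂) ∂(G r₁)
      = havg d lam F G r₁ * havg d lam F G r₂ := by
    simp_rw [integral_const_mul, integral_mul_const]
    rfl
  have hm : Measurable (Function.uncurry fun w₁ w₂ =>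
      hret d lam F G r₁ w₁ * hret d lam F G r₂ w₂) :=
    (meas_hret d lam F G measurable_const measurable_fst).mul
      (meas_hret d lam F G measurable_const measurable_snd)
  have hle1 : ∀ w₁ w₂, hret d lam F G r₁ w₁ * hret d lam F G r₂ w₂ ≤ 1 := fun w₁ w₂ =>
    mul_le_one₀ (hret_le_one d hlam F G _ _) (hret_pos _ _ _ _ _ _).le (hret_le_one d hlam F G _ _)
  have hnn : ∀ w₁ w₂, 0 ≤ hret d lam F G r₁ w₁ * hret d lam F G r₂ w₂ := fun w₁ w₂ =>
    mul_nonneg (hret_pos _ _ _ _ _ _).le (hret_pos _ _ _ _ _ _).le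
  have hup : ∀ w₁ w₂, h2ret d lam F G u r₁ w₁ r₂ w₂ ≤
      hret d lam F G r₁ w₁ * hret d lam F G r₂ w₂ * Real.exp (lam * J) := by
    intro w₁ w₂
    rw [h2ret, if_neg (not_le.2 hu)]
    apply mul_le_mul_of_nonneg_left _ (hnn _ _)
    rw [Real.exp_le_exp]
    exact mul_le_mul_of_nonneg_left (hJ _) hlam.le
  have hlo : ∀ w₁ w₂, hret d lam F G r₁ w₁ * hret d lam F G r₂ w₂ ≤
      h2ret d lam F G u r₁ w₁ r₂ w₂ := by
    intro w₁ w₂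
    rw [h2ret, if_neg (not_le.2 hu)]
    apply le_mul_of_one_le_right (hnn _ _)
    rw [Real.one_le_exp_iff]
    exact mul_nonneg hlam.le (pair_nonneg _ _ _ _ _ _ _)
  have hupC : ∀ w₁ w₂, hret d lam F G r₁ w₁ * hret d lam F G r₂ w₂ * Real.exp (lam * J) ≤
      Real.exp (lam * J) := fun w₁ w₂ =>
    mul_le_of_le_one_left (Real.exp_pos _).le (hle1 _ _)
  have A := dbl_mono (G r₁) (G r₂) hm (meas_h2ret d lam F G u r₁ r₂) hnn hlo
    (fun w₁ w₂ => (hup w₁ w₂).trans (hupC w₁ w₂))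
  have B := dbl_mono (G r₁) (G r₂) (meas_h2ret d lam F G u r₁ r₂)
    (g := fun w₁ w₂ => hret d lam F G r₁ w₁ * hret d lam F G r₂ w₂ * Real.exp (lam * J))
    (hm.mul_const _) (fun _ _ => h2ret_nonneg _ _ _ _ _ _ _ _ _) hup hupC
  simp_rw [integral_mul_const] at B
  rw [hprod] at A
  rw [hprod] at B
  have hE : 1 ≤ Real.exp (lam * J) := by
    rw [Real.one_le_exp_iff]; positivity
  have c := havg_nonneg d lam F G r₁
  have e := havg_nonneg d lam F G r₂
  have f := havg_le_one d hlam F G r₁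
  have f2 := havg_le_one d hlam F G r₂
  have g1 : havg d lam F G r₁ * havg d lam F G r₂ ≤ 1 := mul_le_one₀ f e f2
  rw [qret, abs_le]
  unfold h2avg
  constructor <;> nlinarith

lemma norm_e1 (d : ℕ) (hd : 0 < d) : ‖e1 d‖ = 1 := by
  simp [e1, hd]

lemma pair_le (d : ℕ) (hd : 0 < d) (F : Measure ℝ) [IsProbabilityMeasure F]
    (hsupp : F (Iio 0) = 0) (hmom : Integrable (fun r : ℝ => r ^ d) F)
    (G : Kernel ℝ ℝ) [IsMarkovKernel G] {u r₁ r₂ R : ℝ} (hR : 0 < R) (h1 : 0 ≤ r₁)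
    (h1R : r₁ ≤ R / 8) (h2R : r₂ ≤ R / 8) (hu : 3 * R / 4 ≤ u) (w : ℝ) :
    ∫ r, interVol d 0 (r + r₁) (u • e1 d) (r + r₂) * ((G r) (Ici w)).toReal ∂F
      ≤ ballVol d 1 * 2 ^ d * Mtail d F (R / 8) := by
  have hb : Integrable (fun r => (Ioi (R / 8)).indicator
      (fun r => ballVol d 1 * 2 ^ d * r ^ d) r) F :=
    (hmom.const_mul _).indicator measurableSet_Ioi
  calc _ ≤ ∫ r, (Ioi (R / 8)).indicator (fun r => ballVol d 1 * 2 ^ d * r ^ d) r ∂F := by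
        apply integral_mono_of_nonneg _ hb
        · filter_upwards [ae_nonneg_of_supp hsupp] with r hr
          have hi := interVol_nonneg d 0 (r + r₁) (u • e1 d) (r + r₂)
          refine (mul_le_of_le_one_right hi (Gw_le_one G r w)).trans ?_
          by_cases hrR : R / 8 < r
          · rw [indicator_of_mem (by exact hrR)]
            refine (interVol_le_left _ _ _ _ _).trans ?_
            rw [ballVol_eq d (by linarith), mul_assoc, ← mul_pow]
            have := ballVol_nonneg d 1
            gcongr
            linarith
          · rw [indicator_of_notMem (by exact hrR), interVol_eq_zero]
            rw [dist_zero_left, norm_smul, norm_e1 d hd, mul_one, Real.norm_of_nonneg (by linarith)]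
            linarith
        · exact Eventually.of_forall fun _ =>
            mul_nonneg (interVol_nonneg _ _ _ _ _) (Gw_nonneg _ _ _)
    _ = _ := by
        rw [integral_indicator measurableSet_Ioi, integral_const_mul, Mtail]

lemma qret_dom (d : ℕ) (hd : 0 < d) {lam : ℝ} (hlam : 0 < lam) (F : Measure ℝ)
    [IsProbabilityMeasure F]
    (hsupp : F (Iio 0) = 0) (hmom : Integrable (fun r : ℝ => r ^ d) F)
    {α : ℝ} (hα : (d : ℝ) < α) (hpow : IsPowerLaw F α)
    (G : Kernel ℝ ℝ) [IsMarkovKernel G] :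
    ∃ C > 0, ∀ᶠ R in atTop, ∀ r₁ r₂ u : ℝ, 0 ≤ r₁ → 0 ≤ r₂ → r₁ ≤ R / 8 → r₂ ≤ R / 8 →
      3 * R / 4 ≤ u → |qret d lam F G u r₁ r₂| ≤ C * gtail d F R := by
  obtain ⟨K, hK, hM⟩ := Mtail_le8 d F hmom hα hpow
  set κ := ballVol d 1 with hκ
  have hκ0 : 0 ≤ κ := ballVol_nonneg d 1
  set m := ∫ r, r ^ d ∂F with hm
  have hMm : ∀ x, Mtail d F x ≤ m := by
    intro x
    apply setIntegral_le_integral hmom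
    filter_upwards [ae_nonneg_of_supp hsupp] with r hr
    exact pow_nonneg hr d
  refine ⟨lam * (κ * 2 ^ d * K) * Real.exp (lam * (κ * 2 ^ d * m)) + 1, by positivity, ?_⟩
  filter_upwards [hM, eventually_gt_atTop 0] with R hMR hR r₁ r₂ u h1 h2 h1R h2R hu
  have hg := gtail_pos d F hpow hR
  have h := qret_near d hlam F G (by linarith : r₁ + r₂ < u)
    (pair_le d hd F hsupp hmom G hR h1 h1R h2R hu)
  refine h.trans ?_
  set J := κ * 2 ^ d * Mtail d F (R / 8) with hJ
  have hJ0 : 0 ≤ J := (pair_nonneg d F G u r₁ r₂ 0).trans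
    (pair_le d hd F hsupp hmom G hR h1 h1R h2R hu 0)
  have hexp : Real.exp (lam * J) - 1 ≤ lam * J * Real.exp (lam * J) := by
    have := Real.add_one_le_exp (-(lam * J))
    have h3 : Real.exp (-(lam * J)) * Real.exp (lam * J) = 1 := by
      rw [← Real.exp_add]; simp
    nlinarith [Real.exp_pos (lam * J)]
  calc _ ≤ lam * J * Real.exp (lam * J) := hexp
    _ ≤ lam * (κ * 2 ^ d * (K * gtail d F R)) * Real.exp (lam * (κ * 2 ^ d * m)) := by
        have hJK : J ≤ κ * 2 ^ d * (K * gtail d F R) := by rw [hJ]; gcongr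
        have hJm : J ≤ κ * 2 ^ d * m := by rw [hJ]; gcongr; exact hMm _
        gcongr
    _ ≤ _ := by
        rw [add_mul]
        have : lam * (κ * 2 ^ d * (K * gtail d F R)) * Real.exp (lam * (κ * 2 ^ d * m))
          = lam * (κ * 2 ^ d * K) * Real.exp (lam * (κ * 2 ^ d * m)) * gtail d F R := by ring
        linarith

/-! ### Main argument -/

lemma neBot_comap_norm (d : ℕ) (hd : 0 < d) :
    (comap (norm : Euc d → ℝ) atTop).NeBot := by
  apply comap_neBot
  intro t ht
  obtain ⟨a, ha⟩ := mem_atTop_sets.1 ht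
  refine ⟨(max a 0) • e1 d, ha _ ?_⟩
  rw [norm_smul, norm_e1 d hd, mul_one, Real.norm_of_nonneg (le_max_right _ _)]
  exact le_max_left _ _

lemma innerInt_le (d : ℕ) {q : ℝ → ℝ → ℝ → ℝ} {z : Euc d} {r₁ r₂ B : ℝ}
    (h : ∀ x : Euc d, ‖x‖ ≤ r₁ + r₂ → |q (‖x - z‖) r₁ r₂| ≤ B) :
    |innerInt d q z (r₁, r₂)| ≤ B * (ballVol d r₁ * ballVol d r₂) := by
  obtain ⟨hi, he⟩ := integral_interVol d r₁ r₂
  rw [← he, ← integral_const_mul, ← Real.norm_eq_abs, innerInt]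
  apply norm_integral_le_of_norm_le (hi.const_mul B)
  filter_upwards with x
  rw [norm_mul, Real.norm_of_nonneg (interVol_nonneg _ _ _ _ _), mul_comm]
  by_cases hx : ‖x‖ ≤ r₁ + r₂
  · exact mul_le_mul_of_nonneg_right (h x hx) (interVol_nonneg _ _ _ _ _)
  · rw [interVol_eq_zero d 0 r₁ x r₂ (by rw [dist_zero_left]; linarith)]
    simp

lemma ae_prod_nonneg {F : Measure ℝ} [IsProbabilityMeasure F] (hsupp : F (Iio 0) = 0) :
    ∀ᵐ p ∂(F.prod F), 0 ≤ p.1 ∧ 0 ≤ p.2 := by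
  have h1 := Measure.quasiMeasurePreserving_fst (μ := F) (ν := F) |>.ae (ae_nonneg_of_supp hsupp)
  have h2 := Measure.quasiMeasurePreserving_snd (μ := F) (ν := F) |>.ae (ae_nonneg_of_supp hsupp)
  filter_upwards [h1, h2] with p a b using ⟨a, b⟩

lemma term1_tendsto (d : ℕ) {lam : ℝ} (F : Measure ℝ) [IsProbabilityMeasure F]
    (hsupp : F (Iio 0) = 0) (hmom : Integrable (fun r : ℝ => r ^ d) F)
    {α : ℝ} (hα : (d : ℝ) < α) (hpow : IsPowerLaw F α)
    (G : Kernel ℝ ℝ) [IsMarkovKernel G]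
    (hh0 : Tendsto (havg d lam F G) atTop (nhds 0)) :
    Tendsto (fun z : Euc d => (∫ r, interVol d 0 r z r * havg d lam F G r ∂F) / gtail d F ‖z‖)
      (comap norm atTop) (nhds 0) := by
  obtain ⟨K, hK, hM⟩ := Mtail_le8 d F hmom hα hpow
  have hκ0 : 0 ≤ ballVol d 1 := ballVol_nonneg d 1
  have hn : Tendsto (fun z : Euc d => ‖z‖) (comap norm atTop) atTop := tendsto_comap
  rw [Metric.tendsto_nhds]
  intro ε hε
  set δ := ε / (ballVol d 1 * K + 1) with hδ
  have hδ0 : 0 < δ := by positivity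
  obtain ⟨x0, hx0⟩ := eventually_atTop.1 (hh0.eventually (gt_mem_nhds hδ0))
  filter_upwards [hn.eventually hM, hn.eventually_gt_atTop 0,
    hn.eventually_ge_atTop (8 * x0)] with z hMz hz hzx
  have hg := gtail_pos d F hpow hz
  have hnn : 0 ≤ ∫ r, interVol d 0 r z r * havg d lam F G r ∂F :=
    integral_nonneg fun _ => mul_nonneg (interVol_nonneg _ _ _ _ _) (havg_nonneg _ _ _ _ _)
  rw [dist_zero_right, Real.norm_of_nonneg (by positivity), div_lt_iff₀ hg]
  have hle : ∫ r, interVol d 0 r z r * havg d lam F G r ∂F ≤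
      ∫ r, (Ioi (‖z‖ / 8)).indicator (fun r => δ * ballVol d 1 * r ^ d) r ∂F := by
    apply integral_mono_of_nonneg
    · exact Eventually.of_forall fun _ =>
        mul_nonneg (interVol_nonneg _ _ _ _ _) (havg_nonneg _ _ _ _ _)
    · exact (hmom.const_mul _).indicator measurableSet_Ioi
    · filter_upwards [ae_nonneg_of_supp hsupp] with r hr
      by_cases hrR : ‖z‖ / 8 < r
      · rw [indicator_of_mem (by exact hrR), mul_assoc, ← ballVol_eq d hr, mul_comm δ]
        exact mul_le_mul (interVol_le_left _ _ _ _ _) (hx0 r (by linarith)).le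
          (havg_nonneg _ _ _ _ _) (ballVol_nonneg _ _)
      · rw [indicator_of_notMem (by exact hrR), interVol_eq_zero, zero_mul]
        rw [dist_zero_left]; linarith
  rw [integral_indicator measurableSet_Ioi, integral_const_mul] at hle
  calc _ ≤ δ * ballVol d 1 * Mtail d F (‖z‖ / 8) := hle
    _ ≤ δ * ballVol d 1 * (K * gtail d F ‖z‖) := by gcongr
    _ = δ * (ballVol d 1 * K) * gtail d F ‖z‖ := by ring
    _ < δ * (ballVol d 1 * K + 1) * gtail d F ‖z‖ := by gcongr; linarith
    _ = ε * gtail d F ‖z‖ := by rw [hδ]; field_simp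

lemma innerInt_bound (d : ℕ) {lam : ℝ} (hlam : 0 < lam) (F : Measure ℝ) [IsProbabilityMeasure F]
    (hsupp : F (Iio 0) = 0) (hmom : Integrable (fun r : ℝ => r ^ d) F)
    (G : Kernel ℝ ℝ) [IsMarkovKernel G] (z : Euc d) {r₁ r₂ : ℝ} (h1 : 0 ≤ r₁) (h2 : 0 ≤ r₂) :
    |innerInt d (qret d lam F G) z (r₁, r₂)| ≤
      min (havg d lam F G r₁) (havg d lam F G r₂) * (ballVol d 1 ^ 2 * (r₁ ^ d * r₂ ^ d)) := by
  have h := innerInt_le d (q := qret d lam F G) (z := z) (r₁ := r₁) (r₂ := r₂)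
    (B := min (havg d lam F G r₁) (havg d lam F G r₂)) (fun x _ =>
      le_min (qret_le_left d hlam F hsupp hmom G _ h2) (qret_le_right d hlam F hsupp hmom G _ h1))
  rw [ballVol_eq d h1, ballVol_eq d h2] at h
  refine h.trans (le_of_eq ?_)
  ring

lemma integrable_prodpow (d : ℕ) {F : Measure ℝ} [IsProbabilityMeasure F]
    (hmom : Integrable (fun r : ℝ => r ^ d) F) :
    Integrable (fun p : ℝ × ℝ => p.1 ^ d * p.2 ^ d) (F.prod F) := hmom.mul_prod hmom

lemma integrable_innerInt (d : ℕ) {lam : ℝ} (hlam : 0 < lam) (F : Measure ℝ)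
    [IsProbabilityMeasure F]
    (hsupp : F (Iio 0) = 0) (hmom : Integrable (fun r : ℝ => r ^ d) F)
    (G : Kernel ℝ ℝ) [IsMarkovKernel G] (z : Euc d) :
    Integrable (innerInt d (qret d lam F G) z) (F.prod F) := by
  refine ((integrable_prodpow d hmom).const_mul (ballVol d 1 ^ 2)).mono'
    (measurable_innerInt d lam F G z).aestronglyMeasurable ?_
  filter_upwards [ae_prod_nonneg hsupp] with p hp
  refine (innerInt_bound d hlam F hsupp hmom G z hp.1 hp.2).trans ?_
  apply mul_le_of_le_one_left
  · have := hp.1; have := hp.2; positivity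
  · exact (min_le_left _ _).trans (havg_le_one d hlam F G _)

/-- Pairs of radii that are both small. -/
def smallSet (R : ℝ) : Set (ℝ × ℝ) := Iic (R / 8) ×ˢ Iic (R / 8)

lemma measurableSet_smallSet (R : ℝ) : MeasurableSet (smallSet R) :=
  measurableSet_Iic.prod measurableSet_Iic

lemma term3_tendsto (d : ℕ) {lam : ℝ} (hlam : 0 < lam) (F : Measure ℝ) [IsProbabilityMeasure F]
    (hsupp : F (Iio 0) = 0) (hmom : Integrable (fun r : ℝ => r ^ d) F)
    {α : ℝ} (hα : (d : ℝ) < α) (hpow : IsPowerLaw F α)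
    (G : Kernel ℝ ℝ) [IsMarkovKernel G]
    (hh0 : Tendsto (havg d lam F G) atTop (nhds 0)) :
    Tendsto (fun z : Euc d => (∫ p in (smallSet ‖z‖)ᶜ, innerInt d (qret d lam F G) z p ∂(F.prod F))
      / gtail d F ‖z‖) (comap norm atTop) (nhds 0) := by
  obtain ⟨K, hK, hM⟩ := Mtail_le8 d F hmom hα hpow
  set κ := ballVol d 1 with hκ
  have hκ0 : 0 ≤ κ := ballVol_nonneg d 1
  set m := ∫ r, r ^ d ∂F with hm
  have hm0 : 0 ≤ m := by
    apply integral_nonneg_of_ae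
    filter_upwards [ae_nonneg_of_supp hsupp] with r hr
    exact pow_nonneg hr d
  have hn : Tendsto (fun z : Euc d => ‖z‖) (comap norm atTop) atTop := tendsto_comap
  rw [Metric.tendsto_nhds]
  intro ε hε
  set δ := ε / (2 * κ ^ 2 * m * K + 1) with hδ
  have hδ0 : 0 < δ := by positivity
  obtain ⟨x0, hx0⟩ := eventually_atTop.1 (hh0.eventually (gt_mem_nhds hδ0))
  filter_upwards [hn.eventually hM, hn.eventually_gt_atTop 0,
    hn.eventually_ge_atTop (8 * x0)] with z hMz hz hzx
  have hg := gtail_pos d F hpow hz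
  rw [dist_zero_right, norm_div, Real.norm_of_nonneg hg.le, div_lt_iff₀ hg]
  set T : ℝ → ℝ := (Ioi (‖z‖ / 8)).indicator (fun r => r ^ d) with hT
  have hTi : Integrable T F := hmom.indicator measurableSet_Ioi
  have hTint : ∫ r, T r ∂F = Mtail d F (‖z‖ / 8) := integral_indicator measurableSet_Ioi
  have I1 : Integrable (fun p : ℝ × ℝ => T p.1 * p.2 ^ d) (F.prod F) := hTi.mul_prod hmom
  have I2 : Integrable (fun p : ℝ × ℝ => p.1 ^ d * T p.2) (F.prod F) := hmom.mul_prod hTi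
  have I12 : Integrable (fun p : ℝ × ℝ => T p.1 * p.2 ^ d + p.1 ^ d * T p.2) (F.prod F) :=
    I1.add I2
  have hle : ‖∫ p in (smallSet ‖z‖)ᶜ, innerInt d (qret d lam F G) z p ∂(F.prod F)‖ ≤
      ∫ p, δ * κ ^ 2 * (T p.1 * p.2 ^ d + p.1 ^ d * T p.2) ∂(F.prod F) := by
    rw [← integral_indicator (measurableSet_smallSet _).compl]
    apply norm_integral_le_of_norm_le (I12.const_mul _)
    filter_upwards [ae_prod_nonneg hsupp] with p hp
    have hp1 := pow_nonneg hp.1 d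
    have hp2 := pow_nonneg hp.2 d
    have hT0 : ∀ r, 0 ≤ r → 0 ≤ T r := fun r hr =>
      indicator_apply_nonneg (fun _ => pow_nonneg hr d)
    have hT1 := hT0 _ hp.1
    have hT2 := hT0 _ hp.2
    by_cases hs : p ∈ smallSet ‖z‖
    · rw [indicator_of_notMem (by simpa using hs), norm_zero]
      positivity
    · rw [indicator_of_mem (by exact hs)]
      refine (innerInt_bound d hlam F hsupp hmom G z hp.1 hp.2).trans ?_
      have hor : ‖z‖ / 8 < p.1 ∨ ‖z‖ / 8 < p.2 := by
        by_contra hcon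
        push Not at hcon
        exact hs ⟨hcon.1, hcon.2⟩
      have hmin : min (havg d lam F G p.1) (havg d lam F G p.2) ≤ δ := by
        rcases hor with h | h
        · exact (min_le_left _ _).trans (hx0 _ (by linarith)).le
        · exact (min_le_right _ _).trans (hx0 _ (by linarith)).le
      have hpp : p.1 ^ d * p.2 ^ d ≤ T p.1 * p.2 ^ d + p.1 ^ d * T p.2 := by
        rcases hor with h | h
        · have : T p.1 = p.1 ^ d := indicator_of_mem (by exact h) _
          rw [this]
          linarith [mul_nonneg hp1 hT2]
        · have : T p.2 = p.2 ^ d := indicator_of_mem (by exact h) _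
          rw [this]
          linarith [mul_nonneg hT1 hp2]
      calc _ ≤ δ * (κ ^ 2 * (T p.1 * p.2 ^ d + p.1 ^ d * T p.2)) := by gcongr
        _ = _ := by ring
  rw [integral_const_mul, integral_add I1 I2,
    integral_prod_mul T (fun r : ℝ => r ^ d), integral_prod_mul (fun r : ℝ => r ^ d) T, hTint] at hle
  calc _ ≤ _ := hle
    _ = δ * κ ^ 2 * (2 * m * Mtail d F (‖z‖ / 8)) := by rw [← hm]; ring
    _ ≤ δ * κ ^ 2 * (2 * m * (K * gtail d F ‖z‖)) := by gcongr
    _ = δ * (2 * κ ^ 2 * m * K) * gtail d F ‖z‖ := by ring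
    _ < δ * (2 * κ ^ 2 * m * K + 1) * gtail d F ‖z‖ := by gcongr; linarith
    _ = ε * gtail d F ‖z‖ := by rw [hδ]; field_simp

lemma tendsto_sub_comap_norm (d : ℕ) (x : Euc d) :
    Tendsto (fun z : Euc d => x - z) (comap norm atTop) (comap norm atTop) := by
  rw [tendsto_comap_iff]
  have hn : Tendsto (fun z : Euc d => ‖z‖) (comap norm atTop) atTop := tendsto_comap
  refine tendsto_atTop_mono (f := fun z : Euc d => ‖z‖ - ‖x‖) (fun z => ?_)
    (tendsto_atTop_add_const_right _ _ hn)
  have := norm_sub_norm_le z x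
  rw [norm_sub_rev] at this
  exact this

lemma innerInt_tendsto (d : ℕ) (hd : 0 < d) {lam : ℝ} (hlam : 0 < lam) (F : Measure ℝ)
    [IsProbabilityMeasure F]
    (hsupp : F (Iio 0) = 0) (hmom : Integrable (fun r : ℝ => r ^ d) F)
    {α : ℝ} (hα : (d : ℝ) < α) (hpow : IsPowerLaw F α)
    (G : Kernel ℝ ℝ) [IsMarkovKernel G] {r₁ r₂ Q : ℝ} (h1 : 0 ≤ r₁) (h2 : 0 ≤ r₂)
    (hq : Tendsto (fun z : Euc d => qret d lam F G ‖z‖ r₁ r₂ / (tailF F ‖z‖ * ‖z‖ ^ d))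
        (comap norm atTop) (nhds Q)) :
    Tendsto (fun z : Euc d => innerInt d (qret d lam F G) z (r₁, r₂) / gtail d F ‖z‖)
      (comap norm atTop) (nhds (ballVol d 1 ^ 2 * (r₁ ^ d * r₂ ^ d * Q))) := by
  obtain ⟨C, hC, hdom⟩ := qret_dom d hd hlam F hsupp hmom hα hpow G
  obtain ⟨hi, he⟩ := integral_interVol d r₁ r₂
  have hn : Tendsto (fun z : Euc d => ‖z‖) (comap norm atTop) atTop := tendsto_comap
  have hlim : ∫ x : Euc d, interVol d 0 r₁ x r₂ * Q = ballVol d 1 ^ 2 * (r₁ ^ d * r₂ ^ d * Q) := by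
    rw [integral_mul_const, he, ballVol_eq d h1, ballVol_eq d h2]; ring
  rw [← hlim]
  simp_rw [innerInt, ← integral_div]
  apply tendsto_integral_filter_of_dominated_convergence (fun x => C * interVol d 0 r₁ x r₂)
  · filter_upwards with z
    have h3 := (measurable_integrand d lam F G z).comp
      (measurable_prodMk_left (x := (r₁, r₂)))
    exact (h3.div_const _).aestronglyMeasurable
  · filter_upwards [hn.eventually hdom, hn.eventually_gt_atTop 0,
      hn.eventually_ge_atTop (8 * (r₁ + r₂))] with z hz hz0 hzr
    filter_upwards with x
    have hg := gtail_pos d F hpow hz0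
    rw [norm_div, norm_mul, Real.norm_of_nonneg hg.le, div_le_iff₀ hg,
      Real.norm_of_nonneg (interVol_nonneg _ _ _ _ _)]
    by_cases hx : ‖x‖ ≤ r₁ + r₂
    · have hu : 3 * ‖z‖ / 4 ≤ ‖x - z‖ := by
        have := norm_sub_norm_le z x
        rw [norm_sub_rev] at this
        linarith
      have := hz r₁ r₂ ‖x - z‖ h1 h2 (by linarith) (by linarith) hu
      have h4 := mul_le_mul_of_nonneg_left this (interVol_nonneg d 0 r₁ x r₂)
      rw [Real.norm_eq_abs]
      linarith
    · rw [interVol_eq_zero d 0 r₁ x r₂ (by rw [dist_zero_left]; linarith)]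
      simp
  · exact hi.const_mul C
  · filter_upwards with x
    have hs := tendsto_sub_comap_norm d x
    have h3 := (hq.comp hs).mul (g_shift d F hpow x)
    rw [mul_one] at h3
    have h4 := h3.const_mul (interVol d 0 r₁ x r₂)
    refine h4.congr' ?_
    have hn' := hn.comp hs
    filter_upwards [hn'.eventually_gt_atTop 0] with z hz
    simp only [Function.comp] at hz
    have hg := gtail_pos d F hpow hz
    simp only [Function.comp]
    rw [← gtail, mul_div_assoc]
    congr 1
    field_simp

lemma term2_tendsto (d : ℕ) (hd : 0 < d) {lam : ℝ} (hlam : 0 < lam) (F : Measure ℝ)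
    [IsProbabilityMeasure F]
    (hsupp : F (Iio 0) = 0) (hmom : Integrable (fun r : ℝ => r ^ d) F)
    {α : ℝ} (hα : (d : ℝ) < α) (hpow : IsPowerLaw F α)
    (G : Kernel ℝ ℝ) [IsMarkovKernel G] (qinf : ℝ → ℝ → ℝ)
    (hq : ∀ r₁ r₂ : ℝ, 0 ≤ r₁ → 0 ≤ r₂ →
      Tendsto (fun z : Euc d => qret d lam F G ‖z‖ r₁ r₂ / (tailF F ‖z‖ * ‖z‖ ^ d))
        (comap norm atTop) (nhds (qinf r₁ r₂))) :
    Tendsto (fun z : Euc d => (∫ p in smallSet ‖z‖, innerInt d (qret d lam F G) z p ∂(F.prod F))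
      / gtail d F ‖z‖) (comap norm atTop)
      (nhds (ballVol d 1 ^ 2 * ∫ r₁, (∫ r₂, r₁ ^ d * r₂ ^ d * qinf r₁ r₂ ∂F) ∂F)) := by
  have := neBot_comap_norm d hd
  obtain ⟨C, hC, hdom⟩ := qret_dom d hd hlam F hsupp hmom hα hpow G
  have hκ0 : 0 ≤ ballVol d 1 := ballVol_nonneg d 1
  have hn : Tendsto (fun z : Euc d => ‖z‖) (comap norm atTop) atTop := tendsto_comap
  set f : Euc d → ℝ × ℝ → ℝ := fun z p =>
    (smallSet ‖z‖).indicator (innerInt d (qret d lam F G) z) p / gtail d F ‖z‖ with hf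
  set φ : ℝ × ℝ → ℝ := fun p => ballVol d 1 ^ 2 * (p.1 ^ d * p.2 ^ d * qinf p.1 p.2) with hφ
  set b : ℝ × ℝ → ℝ := fun p => C * ballVol d 1 ^ 2 * (p.1 ^ d * p.2 ^ d) with hb
  have hbi : Integrable b (F.prod F) := (integrable_prodpow d hmom).const_mul _
  have hfm : ∀ z, AEStronglyMeasurable (f z) (F.prod F) := fun z =>
    (((measurable_innerInt d lam F G z).indicator (measurableSet_smallSet _)).div_const
      _).aestronglyMeasurable
  have hfb : ∀ᶠ z in comap norm atTop, ∀ p : ℝ × ℝ, 0 ≤ p.1 ∧ 0 ≤ p.2 → ‖f z p‖ ≤ b p := by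
    filter_upwards [hn.eventually hdom, hn.eventually_gt_atTop 0] with z hz hz0 p hp
    have hg := gtail_pos d F hpow hz0
    have hp1 := pow_nonneg hp.1 d
    have hp2 := pow_nonneg hp.2 d
    simp only [hf, hb]
    rw [norm_div, Real.norm_of_nonneg hg.le, div_le_iff₀ hg]
    by_cases hs : p ∈ smallSet ‖z‖
    · rw [indicator_of_mem hs]
      have hs1 : p.1 ≤ ‖z‖ / 8 := hs.1
      have hs2 : p.2 ≤ ‖z‖ / 8 := hs.2
      have h := innerInt_le d (q := qret d lam F G) (z := z) (r₁ := p.1) (r₂ := p.2)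
        (B := C * gtail d F ‖z‖) (fun x hx => hz p.1 p.2 ‖x - z‖ hp.1 hp.2 hs1 hs2 (by
          have := norm_sub_norm_le z x
          rw [norm_sub_rev] at this
          linarith))
      rw [ballVol_eq d hp.1, ballVol_eq d hp.2] at h
      refine h.trans (le_of_eq ?_)
      ring
    · rw [indicator_of_notMem hs, norm_zero]
      positivity
  have hft : ∀ p : ℝ × ℝ, 0 ≤ p.1 ∧ 0 ≤ p.2 →
      Tendsto (fun z => f z p) (comap norm atTop) (nhds (φ p)) := by
    intro p hp
    refine (innerInt_tendsto d hd hlam F hsupp hmom hα hpow G hp.1 hp.2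
      (hq p.1 p.2 hp.1 hp.2)).congr' ?_
    filter_upwards [hn.eventually_ge_atTop (8 * (p.1 + p.2))] with z hz
    simp only [hf]
    rw [indicator_of_mem]
    exact ⟨show p.1 ≤ ‖z‖ / 8 by linarith [hp.1, hp.2], show p.2 ≤ ‖z‖ / 8 by linarith [hp.1, hp.2]⟩
  have hft' : ∀ᵐ p ∂(F.prod F), Tendsto (fun z => f z p) (comap norm atTop) (nhds (φ p)) := by
    filter_upwards [ae_prod_nonneg hsupp] with p hp using hft p hp
  have hφm : AEStronglyMeasurable φ (F.prod F) :=
    aestronglyMeasurable_of_tendsto_ae (comap norm atTop) hfm hft'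
  have hφi : Integrable φ (F.prod F) := by
    refine hbi.mono' hφm ?_
    filter_upwards [ae_prod_nonneg hsupp] with p hp
    refine le_of_tendsto (hft p hp).norm ?_
    filter_upwards [hfb] with z hz using hz p hp
  have hmain := tendsto_integral_filter_of_dominated_convergence (μ := F.prod F) b
    (Eventually.of_forall hfm)
    (hfb.mono fun z hz => (ae_prod_nonneg hsupp).mono fun p hp => hz p hp) hbi hft'
  rw [integral_prod _ hφi] at hmain
  simp only [hφ, integral_const_mul] at hmain
  refine hmain.congr fun z => ?_
  simp only [hf]
  rw [integral_div, integral_indicator (measurableSet_smallSet _)]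

/-- Asymptotics of the covariance function of the thinned grain cover, assuming the
retention probability vanishes at infinity and the retention covariance has the
decay `q(|z|,r₁,r₂) ∼ q_∞(r₁,r₂) F̄(|z|) |z|^d`. -/
theorem stmt11 (d : ℕ) (hd : 0 < d) (lam : ℝ) (hlam : 0 < lam)
    (F : Measure ℝ) [IsProbabilityMeasure F] (hsupp : F (Iio 0) = 0)
    (hmom : Integrable (fun r : ℝ => r ^ d) F)
    (α : ℝ) (hα : (d : ℝ) < α) (hpow : IsPowerLaw F α)
    (G : Kernel ℝ ℝ) [IsMarkovKernel G]
    (hh0 : Tendsto (havg d lam F G) atTop (nhds 0))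
    (qinf : ℝ → ℝ → ℝ)
    (hq : ∀ r₁ r₂ : ℝ, 0 ≤ r₁ → 0 ≤ r₂ →
      Tendsto (fun z : Euc d => qret d lam F G ‖z‖ r₁ r₂ / (tailF F ‖z‖ * ‖z‖ ^ d))
        (comap norm atTop) (nhds (qinf r₁ r₂))) :
    Tendsto
      (fun z : Euc d =>
        kth d lam F (havg d lam F G) (qret d lam F G) z / (tailF F ‖z‖ * ‖z‖ ^ d))
      (comap norm atTop)
      (nhds (lam ^ 2 * ballVol d 1 ^ 2 *
        ∫ r₁, (∫ r₂, r₁ ^ d * r₂ ^ d * qinf r₁ r₂ ∂F) ∂F)) := by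

  have t1 := (term1_tendsto d F hsupp hmom hα hpow G hh0).const_mul lam
  have t2 := (term2_tendsto d hd hlam F hsupp hmom hα hpow G qinf hq).const_mul (lam ^ 2)
  have t3 := (term3_tendsto d hlam F hsupp hmom hα hpow G hh0).const_mul (lam ^ 2)
  have t := (t1.add t2).add t3
  simp only [mul_zero, zero_add, add_zero, ← mul_assoc] at t
  simp only [mul_assoc] at t ⊢
  refine t.congr fun z => ?_
  have hI := integrable_innerInt d hlam F hsupp hmom G z
  have e : kth d lam F (havg d lam F G) (qret d lam F G) z =
      lam * ∫ r, interVol d 0 r z r * havg d lam F G r ∂F + lam ^ 2 *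
        (∫ p in smallSet ‖z‖, innerInt d (qret d lam F G) z p ∂(F.prod F) +
        ∫ p in (smallSet ‖z‖)ᶜ, innerInt d (qret d lam F G) z p ∂(F.prod F)) := by
    rw [integral_add_compl (measurableSet_smallSet _) hI, integral_prod _ hI]
    rfl
  rw [e, ← gtail]
  ring
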